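/- arXiv:1902.08084 — 2 statements merged into one kernel-verified Lean document; each statement's English description precedes it below -/
import Mathlib

section
/- The vector field b belongs to the fractional Sobolev space W^{s,1}_loc(ℝ³;ℝ³) for every s with 0 < s < 1/2: for every such s and every compact set K ⊂ ℝ³, the Gagliardo seminorm ∬_{K×K} |b(x) − b(y)| / |x − y|^{3+s} dx dy is finite. -/
open MeasureTheory Real Set Filter Topology
open scoped ENNReal

noncomputable section

/-- The upper paraboloid `P⁺ = {(x,y,z) : x² + y² ≤ z}`. -/
def Pplus : Set (ℝ × ℝ × ℝ) := {p | p.1 ^ 2 + p.2.1 ^ 2 ≤ p.2.2}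

/-- The lower paraboloid `P⁻ = {(x,y,z) : x² + y² ≤ -z}`. -/
def Pminus : Set (ℝ × ℝ × ℝ) := {p | p.1 ^ 2 + p.2.1 ^ 2 ≤ -p.2.2}

/-- `P = P⁺ ∪ P⁻`. -/
def PP : Set (ℝ × ℝ × ℝ) := Pplus ∪ Pminus

open scoped Classical in
/-- The vector field `b(x,y,z) = (-sgn z · x/z², -sgn z · y/z², -2/|z|)` on `P \ {z = 0}`,
and `0` elsewhere. -/
def bb : ℝ × ℝ × ℝ → ℝ × ℝ × ℝ := fun p =>
  if p ∈ PP ∧ p.2.2 ≠ 0 then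
    (-(Real.sign p.2.2) * p.1 / p.2.2 ^ 2,
     -(Real.sign p.2.2) * p.2.1 / p.2.2 ^ 2,
     -2 / |p.2.2|)
  else (0, 0, 0)

lemma lintegral_closedBall_enorm_rpow_lt_top {E : Type*} [NormedAddCommGroup E]
    [NormedSpace ℝ E] [FiniteDimensional ℝ E] [Nontrivial E] [MeasurableSpace E] [BorelSpace E]
    (μ : Measure E) [μ.IsAddHaarMeasure] {β : ℝ} (hβ : β < Module.finrank ℝ E) (R : ℝ) :
    ∫⁻ x in Metric.closedBall (0 : E) R, ‖x‖ₑ ^ (-β) ∂μ < ⊤ := by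
  have hint : Integrable (fun x : E => (Iic R).indicator (fun r : ℝ => r ^ (-β)) ‖x‖) μ := by
    rw [integrable_fun_norm_addHaar]
    have h : IntegrableOn (fun r : ℝ => r ^ ((Module.finrank ℝ E : ℝ) - 1 - β)) (Ioc 0 R) := by
      rcases le_total R 0 with hR | hR
      · simp [Ioc_eq_empty_of_le hR]
      · rw [← intervalIntegrable_iff_integrableOn_Ioc_of_le hR]
        exact intervalIntegral.intervalIntegrable_rpow' (by linarith)
    have h2 := (h.integrable_indicator measurableSet_Ioc).integrableOn (s := Ioi 0)
    refine h2.congr_fun (fun r hr => ?_) measurableSet_Ioi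
    have hr0 : (0 : ℝ) < r := hr
    by_cases hrR : r ≤ R
    · have h1 : r ∈ Ioc 0 R := ⟨hr0, hrR⟩
      have h3 : r ∈ Iic R := hrR
      have : 1 ≤ Module.finrank ℝ E := Module.finrank_pos
      simp only [indicator_of_mem h1, indicator_of_mem h3, smul_eq_mul]
      rw [← Real.rpow_natCast, ← Real.rpow_add hr0]
      congr 1
      push_cast [this]
      ring
    · have h1 : r ∉ Ioc 0 R := fun h => hrR h.2
      have h3 : r ∉ Iic R := hrR
      simp [indicator_of_notMem h1, indicator_of_notMem h3]
  have hfin := hint.lintegral_lt_top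
  refine lt_of_le_of_lt ?_ hfin
  rw [← lintegral_indicator Metric.isClosed_closedBall.measurableSet]
  refine lintegral_mono_ae ?_
  filter_upwards [compl_mem_ae_iff.2 (measure_singleton (μ := μ) (0 : E))] with x hx
  have hx0 : 0 < ‖x‖ := norm_pos_iff.2 hx
  by_cases hxR : x ∈ Metric.closedBall (0 : E) R
  · have h3 : ‖x‖ ∈ Iic R := by simpa using hxR
    rw [indicator_of_mem hxR, indicator_of_mem h3, ← ofReal_norm, ENNReal.ofReal_rpow_of_pos hx0]
  · simp [indicator_of_notMem hxR]

lemma bb_of_mem {p : ℝ × ℝ × ℝ} (hp : p ∈ PP) (hz : p.2.2 ≠ 0) :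
    bb p = (-(Real.sign p.2.2) * p.1 / p.2.2 ^ 2, -(Real.sign p.2.2) * p.2.1 / p.2.2 ^ 2,
      -2 / |p.2.2|) := by
  simp [bb, hp, hz]

lemma bb_of_notMem {p : ℝ × ℝ × ℝ} (hp : p ∉ PP) : bb p = 0 := by
  simp [bb, hp]

lemma mem_PP_iff {p : ℝ × ℝ × ℝ} : p ∈ PP ↔ p.1 ^ 2 + p.2.1 ^ 2 ≤ |p.2.2| := by
  simp [PP, Pplus, Pminus, le_abs]

lemma norm_le_iff_abs_le {p : ℝ × ℝ × ℝ} {r : ℝ} :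
    ‖p‖ ≤ r ↔ |p.1| ≤ r ∧ |p.2.1| ≤ r ∧ |p.2.2| ≤ r := by
  simp [Prod.norm_def]

lemma abs_sign_mul {z : ℝ} (hz : z ≠ 0) (x : ℝ) : |(-(Real.sign z)) * x| = |x| := by
  rcases Real.sign_apply_eq_of_ne_zero z hz with h | h <;> simp [h]

lemma abs_le_sqrt_of_mem_PP {p : ℝ × ℝ × ℝ} (hp : p ∈ PP) :
    |p.1| ≤ √|p.2.2| ∧ |p.2.1| ≤ √|p.2.2| := by
  rw [mem_PP_iff] at hp
  constructor <;> apply Real.abs_le_sqrt <;> nlinarith [sq_nonneg p.1, sq_nonneg p.2.1]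

lemma norm_bb_le {p : ℝ × ℝ × ℝ} {R : ℝ} (hR : 1 ≤ R) (hp : p ∈ PP) (hz : p.2.2 ≠ 0)
    (hpR : ‖p‖ ≤ R) : ‖bb p‖ ≤ 2 * R / √|p.2.2| ^ 3 := by
  obtain ⟨hx, hy⟩ := abs_le_sqrt_of_mem_PP hp
  have hzR := (norm_le_iff_abs_le.1 hpR).2.2
  have hv : 0 < |p.2.2| := abs_pos.2 hz
  have ht : 0 < √|p.2.2| := Real.sqrt_pos.2 hv
  have htR : √|p.2.2| ≤ R := by
    rw [Real.sqrt_le_left (by linarith)]; nlinarith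
  have key : ∀ x : ℝ, |x| ≤ √|p.2.2| →
      |(-(Real.sign p.2.2)) * x / p.2.2 ^ 2| ≤ 2 * R / √|p.2.2| ^ 3 := by
    intro x hx
    rw [abs_div, abs_sign_mul hz, abs_pow]
    nth_rw 1 [← Real.sq_sqrt hv.le]
    rw [div_le_div_iff₀ (by positivity) (by positivity)]
    have : |x| * √|p.2.2| ^ 3 ≤ √|p.2.2| * √|p.2.2| ^ 3 := by gcongr
    have h4 : 0 < √|p.2.2| ^ 4 := by positivity
    nlinarith
  rw [bb_of_mem hp hz, norm_le_iff_abs_le]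
  refine ⟨key _ hx, key _ hy, ?_⟩
  rw [abs_div, abs_abs, abs_neg, abs_two]
  nth_rw 1 [← Real.sq_sqrt hv.le]
  rw [div_le_div_iff₀ (by positivity) (by positivity)]
  have h4 : 0 < √|p.2.2| ^ 2 := by positivity
  nlinarith

lemma abs_div_pow_four_sub_le {x x' t t' d R : ℝ} (ht : 0 < t) (ht' : 0 < t') (htR : t ≤ R)
    (hx' : |x'| ≤ t') (hxd : |x - x'| ≤ d) (htd : |t ^ 2 - t' ^ 2| ≤ d) (hd : d ≤ t ^ 2 / 2)
    (hR : 1 ≤ R) : |x / t ^ 4 - x' / t' ^ 4| ≤ 20 * R * d / t ^ 5 := by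
  obtain ⟨h1, h2⟩ := abs_le.1 htd
  have hd0 : 0 ≤ d := (abs_nonneg _).trans hxd
  have htt : 2 / 3 * t ≤ t' := by
    nlinarith
  have h3 : t ^ 3 / 4 ≤ t' ^ 3 := by
    have : (2 / 3 * t) ^ 3 ≤ t' ^ 3 := by gcongr
    nlinarith [pow_pos ht 3]
  have e : x / t ^ 4 - x' / t' ^ 4
      = (x - x') / t ^ 4 + x' * ((t' ^ 2 - t ^ 2) * (t ^ 2 + t' ^ 2)) / (t ^ 4 * t' ^ 4) := by
    field_simp
    ring
  have b1 : |(x - x') / t ^ 4| ≤ R * d / t ^ 5 := by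
    rw [abs_div, abs_of_pos (pow_pos ht 4), div_le_div_iff₀ (by positivity) (by positivity)]
    have : |x - x'| * t ^ 5 ≤ d * t ^ 5 := by gcongr
    have h5 : d * t ^ 4 * t ≤ d * t ^ 4 * R := by gcongr
    nlinarith
  have b2 : |x' * ((t' ^ 2 - t ^ 2) * (t ^ 2 + t' ^ 2)) / (t ^ 4 * t' ^ 4)| ≤ 10 * d / t ^ 5 := by
    rw [abs_div, abs_mul, abs_mul, abs_sub_comm (t' ^ 2), abs_of_pos (by positivity : 0 < t ^ 2 + t' ^ 2),
      abs_of_pos (by positivity : 0 < t ^ 4 * t' ^ 4)]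
    calc _ ≤ t' * (d * (5 / 2 * t ^ 2)) / (t ^ 4 * t' ^ 4) := by
            gcongr
            linarith
      _ = (5 / 2 * d) / (t ^ 2 * t' ^ 3) := by field_simp
      _ ≤ (5 / 2 * d) / (t ^ 2 * (t ^ 3 / 4)) := by gcongr
      _ = 10 * d / t ^ 5 := by field_simp; ring
  rw [e]
  refine (abs_add_le _ _).trans ((add_le_add b1 b2).trans ?_)
  rw [← add_div]
  gcongr
  nlinarith

lemma norm_bb_sub_le {p q : ℝ × ℝ × ℝ} {R : ℝ} (hR : 1 ≤ R) (hp : p ∈ PP) (hq : q ∈ PP)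
    (hz : p.2.2 ≠ 0) (hpR : ‖p‖ ≤ R) (hd : ‖p - q‖ ≤ |p.2.2| / 2) :
    ‖bb p - bb q‖ ≤ 20 * R * ‖p - q‖ / √|p.2.2| ^ 5 := by
  obtain ⟨hx, hy⟩ := abs_le_sqrt_of_mem_PP hq
  have hzR := (norm_le_iff_abs_le.1 hpR).2.2
  obtain ⟨dx, dy, dz⟩ := norm_le_iff_abs_le.1 (le_refl ‖p - q‖)
  simp only [Prod.fst_sub, Prod.snd_sub] at dx dy dz
  have hv : 0 < |p.2.2| := abs_pos.2 hz
  have hdv : |(|p.2.2| - |q.2.2|)| ≤ ‖p - q‖ := (abs_abs_sub_abs_le_abs_sub _ _).trans dz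
  have hv' : 0 < |q.2.2| := by linarith [(abs_le.1 hdv).2]
  have hzq : q.2.2 ≠ 0 := abs_pos.1 hv'
  have ht : 0 < √|p.2.2| := Real.sqrt_pos.2 hv
  have ht' : 0 < √|q.2.2| := Real.sqrt_pos.2 hv'
  have htR : √|p.2.2| ≤ R := by
    rw [Real.sqrt_le_left (by linarith)]; nlinarith
  have hsign : Real.sign q.2.2 = Real.sign p.2.2 := by
    have := (abs_le.1 (dz.trans hd))
    rcases hz.lt_or_gt with h | h
    · rw [abs_of_neg h] at this
      rw [Real.sign_of_neg h, Real.sign_of_neg (by linarith)]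
    · rw [abs_of_pos h] at this
      rw [Real.sign_of_pos h, Real.sign_of_pos (by linarith)]
  have e1 : p.2.2 ^ 2 = √|p.2.2| ^ 4 := by
    rw [← sq_abs, show 4 = 2 * 2 from rfl, pow_mul, Real.sq_sqrt hv.le]
  have e2 : q.2.2 ^ 2 = √|q.2.2| ^ 4 := by
    rw [← sq_abs q.2.2, show 4 = 2 * 2 from rfl, pow_mul, Real.sq_sqrt hv'.le]
  have key : ∀ x x' : ℝ, |x'| ≤ √|q.2.2| → |x - x'| ≤ ‖p - q‖ →
      |(-(Real.sign p.2.2)) * x / p.2.2 ^ 2 - (-(Real.sign q.2.2)) * x' / q.2.2 ^ 2|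
        ≤ 20 * R * ‖p - q‖ / √|p.2.2| ^ 5 := by
    intro x x' hx' hxd
    rw [hsign, mul_div_assoc, mul_div_assoc, ← mul_sub, abs_sign_mul hz, e1, e2]
    refine abs_div_pow_four_sub_le ht ht' htR hx' hxd ?_ ?_ hR
    · rwa [Real.sq_sqrt hv.le, Real.sq_sqrt hv'.le]
    · rwa [Real.sq_sqrt hv.le]
  rw [bb_of_mem hp hz, bb_of_mem hq hzq, norm_le_iff_abs_le]
  refine ⟨key _ _ hx dx, key _ _ hy dy, ?_⟩
  simp only [Prod.snd_sub]
  have e3 : -2 / |p.2.2| - -2 / |q.2.2| = 2 * (|p.2.2| - |q.2.2|) / (|p.2.2| * |q.2.2|) := by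
    field_simp
    ring
  rw [e3, abs_div, abs_mul, abs_two, abs_of_pos (mul_pos hv hv')]
  calc _ ≤ 2 * ‖p - q‖ / (|p.2.2| * (|p.2.2| / 2)) := by
          gcongr
          linarith [(abs_le.1 hdv).2]
    _ = 4 * √|p.2.2| * ‖p - q‖ / √|p.2.2| ^ 5 := by
          nth_rw 1 2 [← Real.sq_sqrt hv.le]
          field_simp
          ring
    _ ≤ _ := by
          gcongr
          linarith
/-- The vertical distance from a point of `P` to the boundary of `P`. -/
def depth (p : ℝ × ℝ × ℝ) : ℝ := |p.2.2| - (p.1 ^ 2 + p.2.1 ^ 2)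

lemma depth_nonneg {p : ℝ × ℝ × ℝ} (hp : p ∈ PP) : 0 ≤ depth p := by
  rw [mem_PP_iff] at hp
  simpa [depth] using hp

lemma depth_le (p : ℝ × ℝ × ℝ) : depth p ≤ |p.2.2| := by
  simp only [depth]
  nlinarith [sq_nonneg p.1, sq_nonneg p.2.1]

lemma depth_le_of_notMem {p q : ℝ × ℝ × ℝ} {R : ℝ} (hR : 1 ≤ R) (hq : q ∉ PP)
    (hpR : ‖p‖ ≤ R) (hqR : ‖q‖ ≤ R) : depth p ≤ 5 * R * ‖p - q‖ := by
  rw [mem_PP_iff, not_le] at hq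
  obtain ⟨dx, dy, dz⟩ := norm_le_iff_abs_le.1 (le_refl ‖p - q‖)
  obtain ⟨px, py, -⟩ := norm_le_iff_abs_le.1 hpR
  obtain ⟨qx, qy, -⟩ := norm_le_iff_abs_le.1 hqR
  simp only [Prod.fst_sub, Prod.snd_sub] at dx dy dz
  have key : ∀ x y : ℝ, |x| ≤ R → |y| ≤ R → |x - y| ≤ ‖p - q‖ →
      y ^ 2 - x ^ 2 ≤ 2 * R * ‖p - q‖ := by
    intro x y hx hy hxy
    calc y ^ 2 - x ^ 2 ≤ |(y + x) * (y - x)| := by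
          rw [← sq_sub_sq]; exact le_abs_self _
      _ ≤ (R + R) * ‖p - q‖ := by
          rw [abs_mul, abs_sub_comm y x]
          gcongr
          exact (abs_add_le _ _).trans (add_le_add hy hx)
      _ = _ := by ring
  have h1 := key _ _ px qx dx
  have h2 := key _ _ py qy dy
  have h3 : |p.2.2| - |q.2.2| ≤ ‖p - q‖ := (abs_sub_abs_le_abs_sub _ _).trans dz
  have h4 := norm_nonneg (p - q)
  simp only [depth]
  nlinarith

open scoped Classical in
/-- The function `|z|^{-3/2} (|z| - x² - y²)^{-σ}` on `P`, extended by zero. -/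
def weight (σ : ℝ) (p : ℝ × ℝ × ℝ) : ℝ :=
  if p ∈ PP then 1 / √|p.2.2| ^ 3 * depth p ^ (-σ) else 0

lemma weight_nonneg (σ : ℝ) (p : ℝ × ℝ × ℝ) : 0 ≤ weight σ p := by
  unfold weight
  split_ifs with h
  · have := Real.rpow_nonneg (depth_nonneg h) (-σ)
    positivity
  · rfl

lemma norm_bb_le_weight {p : ℝ × ℝ × ℝ} {R σ d : ℝ} (hR : 1 ≤ R) (hσ0 : 0 ≤ σ) (hσ1 : σ ≤ 1)
    (hp : p ∈ PP) (hw : 0 < depth p) (hpR : ‖p‖ ≤ R) (hd : depth p ≤ 5 * R * d) :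
    ‖bb p‖ ≤ 20 * R ^ 2 * weight σ p * d ^ σ := by
  have hv : 0 < |p.2.2| := hw.trans_le (depth_le p)
  have hd0 : 0 < d := by
    by_contra! h
    nlinarith
  have h1 : 1 ≤ 5 * R * (depth p ^ (-σ) * d ^ σ) := by
    have h2 : depth p ^ σ ≤ (5 * R) ^ σ * d ^ σ := by
      rw [← Real.mul_rpow (by positivity) hd0.le]
      exact Real.rpow_le_rpow hw.le hd hσ0
    have h3 : (5 * R) ^ σ ≤ 5 * R := Real.rpow_le_self_of_one_le (by linarith) hσ1
    calc 1 = depth p ^ (-σ) * depth p ^ σ := by rw [← Real.rpow_add hw]; simp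
      _ ≤ depth p ^ (-σ) * (5 * R * d ^ σ) := by
          gcongr
          refine h2.trans ?_
          gcongr
      _ = _ := by ring
  have h4 := norm_bb_le hR hp (abs_pos.1 hv) hpR
  rw [weight, if_pos hp]
  calc ‖bb p‖ ≤ 2 * R / √|p.2.2| ^ 3 * 1 := by simpa using h4
    _ ≤ 2 * R / √|p.2.2| ^ 3 * (5 * R * (depth p ^ (-σ) * d ^ σ)) := by gcongr
    _ = 10 * (R ^ 2 * (1 / √|p.2.2| ^ 3 * depth p ^ (-σ) * d ^ σ)) := by ring
    _ ≤ 20 * (R ^ 2 * (1 / √|p.2.2| ^ 3 * depth p ^ (-σ) * d ^ σ)) := by gcongr; norm_num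
    _ = _ := by ring

lemma norm_bb_sub_le_weight_of_near {p q : ℝ × ℝ × ℝ} {R σ : ℝ} (hR : 1 ≤ R) (hσ0 : 0 ≤ σ)
    (hσ1 : σ ≤ 1) (hp : p ∈ PP) (hq : q ∈ PP) (hw : 0 < depth p) (hpR : ‖p‖ ≤ R)
    (hpq : p ≠ q) (hd : ‖p - q‖ ≤ |p.2.2| / 2) :
    ‖bb p - bb q‖ ≤ 20 * R ^ 2 * weight σ p * ‖p - q‖ ^ σ := by
  have hv : 0 < |p.2.2| := hw.trans_le (depth_le p)
  have hd0 : 0 < ‖p - q‖ := norm_pos_iff.2 (sub_ne_zero.2 hpq)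
  have ht : 0 < √|p.2.2| := Real.sqrt_pos.2 hv
  have h1 : ‖p - q‖ / |p.2.2| ≤ depth p ^ (-σ) * ‖p - q‖ ^ σ :=
    calc ‖p - q‖ / |p.2.2| ≤ (‖p - q‖ / |p.2.2|) ^ σ := by
          refine Real.self_le_rpow_of_le_one (by positivity) ?_ hσ1
          rw [div_le_one hv]
          linarith
      _ ≤ (‖p - q‖ / depth p) ^ σ := by
          gcongr
          exact depth_le p
      _ = _ := by
          rw [Real.div_rpow hd0.le hw.le, Real.rpow_neg hw.le, div_eq_mul_inv, mul_comm]
  rw [weight, if_pos hp]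
  calc ‖bb p - bb q‖ ≤ 20 * R * ‖p - q‖ / √|p.2.2| ^ 5 :=
        norm_bb_sub_le hR hp hq (abs_pos.1 hv) hpR hd
    _ = 20 * R * (1 / √|p.2.2| ^ 3) * (‖p - q‖ / |p.2.2|) := by
        nth_rw 3 [← Real.sq_sqrt hv.le]
        field_simp
    _ ≤ 20 * R ^ 2 * (1 / √|p.2.2| ^ 3) * (depth p ^ (-σ) * ‖p - q‖ ^ σ) := by
        gcongr
        nlinarith
    _ = _ := by ring

lemma norm_bb_sub_le_weight_add {p q : ℝ × ℝ × ℝ} {R σ : ℝ} (hR : 1 ≤ R) (hσ0 : 0 ≤ σ)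
    (hσ1 : σ ≤ 1) (hp : p ∈ PP → 0 < depth p) (hq : q ∈ PP → 0 < depth q)
    (hpR : ‖p‖ ≤ R) (hqR : ‖q‖ ≤ R) (hpq : p ≠ q) :
    ‖bb p - bb q‖ ≤ 20 * R ^ 2 * (weight σ p + weight σ q) * ‖p - q‖ ^ σ := by
  have hgp := weight_nonneg σ p
  have hgq := weight_nonneg σ q
  have hd0 : 0 < ‖p - q‖ := norm_pos_iff.2 (sub_ne_zero.2 hpq)
  have hdσ := Real.rpow_pos_of_pos hd0 σ
  rw [mul_add, add_mul]
  have np : 0 ≤ 20 * R ^ 2 * weight σ p * ‖p - q‖ ^ σ := by positivity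
  have nq : 0 ≤ 20 * R ^ 2 * weight σ q * ‖p - q‖ ^ σ := by positivity
  by_cases hpP : p ∈ PP <;> by_cases hqP : q ∈ PP
  · rcases le_or_gt ‖p - q‖ (|p.2.2| / 2) with h | h
    · linarith [norm_bb_sub_le_weight_of_near hR hσ0 hσ1 hpP hqP (hp hpP) hpR hpq h]
    · have dz := (norm_le_iff_abs_le.1 (le_refl ‖p - q‖)).2.2
      simp only [Prod.snd_sub] at dz
      have h3 : |q.2.2| - |p.2.2| ≤ ‖p - q‖ := by
        rw [abs_sub_comm] at dz
        exact (abs_sub_abs_le_abs_sub _ _).trans dz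
      refine (norm_sub_le _ _).trans (add_le_add ?_ ?_)
      · refine norm_bb_le_weight hR hσ0 hσ1 hpP (hp hpP) hpR ?_
        have := depth_le p
        nlinarith
      · refine norm_bb_le_weight hR hσ0 hσ1 hqP (hq hqP) hqR ?_
        have := depth_le q
        nlinarith
  · have := norm_bb_le_weight hR hσ0 hσ1 hpP (hp hpP) hpR (depth_le_of_notMem hR hqP hpR hqR)
    rw [bb_of_notMem hqP, sub_zero]
    linarith
  · have := norm_bb_le_weight hR hσ0 hσ1 hqP (hq hqP) hqR (depth_le_of_notMem hR hpP hqR hpR)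
    rw [bb_of_notMem hpP, zero_sub, norm_neg]
    rw [norm_sub_rev] at this
    linarith
  · rw [bb_of_notMem hpP, bb_of_notMem hqP, sub_zero, norm_zero]
    positivity

/-- The power `‖x‖ ^ (-β)`, cut off outside the ball of radius `R`. -/
def cutPow {E : Type*} [NormedAddCommGroup E] (β R : ℝ) : E → ℝ≥0∞ :=
  (Metric.closedBall (0 : E) R).indicator fun x => ‖x‖ₑ ^ (-β)

lemma cutPow_of_norm_le {E : Type*} [NormedAddCommGroup E] (β : ℝ) {R : ℝ} {x : E}
    (hx : ‖x‖ ≤ R) : cutPow β R x = ‖x‖ₑ ^ (-β) :=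
  indicator_of_mem (by simpa using hx) _

lemma measurable_cutPow {E : Type*} [NormedAddCommGroup E] [MeasurableSpace E]
    [BorelSpace E] (β R : ℝ) : Measurable (cutPow β R : E → ℝ≥0∞) :=
  (by fun_prop : Measurable fun x : E => ‖x‖ₑ ^ (-β)).indicator
    Metric.isClosed_closedBall.measurableSet

/-- An integrable majorant of `weight`, a product of powers after a shear. -/
def majorant (β τ R : ℝ) (p : ℝ × ℝ × ℝ) : ℝ≥0∞ :=
  cutPow β R (p.1, p.2.1) * (cutPow τ R (p.2.2 - (p.1 ^ 2 + p.2.1 ^ 2)) +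
    cutPow τ R (-p.2.2 - (p.1 ^ 2 + p.2.1 ^ 2)))

lemma measurable_majorant (β τ R : ℝ) : Measurable (majorant β τ R) := by
  have h1 := (measurable_cutPow (E := ℝ × ℝ) β R)
  have h2 := (measurable_cutPow (E := ℝ) τ R)
  unfold majorant
  fun_prop

lemma cutPow_mul_le_majorant {β τ R : ℝ} (p : ℝ × ℝ × ℝ) :
    cutPow β R (p.1, p.2.1) * cutPow τ R (depth p) ≤ majorant β τ R p := by
  unfold majorant depth
  gcongr
  rcases abs_choice p.2.2 with h | h <;> rw [h]
  · exact le_self_add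
  · exact le_add_self

lemma norm_depth_le {p : ℝ × ℝ × ℝ} {R : ℝ} (hp : p ∈ PP) (hpR : ‖p‖ ≤ R) :
    ‖depth p‖ ≤ R := by
  rw [Real.norm_of_nonneg (depth_nonneg hp)]
  exact (depth_le p).trans (norm_le_iff_abs_le.1 hpR).2.2

lemma norm_horizontal_le {p : ℝ × ℝ × ℝ} {R : ℝ} (hpR : ‖p‖ ≤ R) : ‖(p.1, p.2.1)‖ ≤ R := by
  obtain ⟨h1, h2, -⟩ := norm_le_iff_abs_le.1 hpR
  exact max_le h1 h2

lemma enorm_rpow_neg_ne_zero {E : Type*} [NormedAddCommGroup E] {β : ℝ} (hβ : 0 ≤ β) (x : E) :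
    ‖x‖ₑ ^ (-β) ≠ 0 := by
  rw [Ne, ENNReal.rpow_eq_zero_iff]
  rintro (⟨-, h⟩ | ⟨h, -⟩)
  · linarith
  · exact enorm_ne_top h

lemma majorant_eq_top {β τ R : ℝ} (hβ : 0 < β) (hτ : 0 < τ) {p : ℝ × ℝ × ℝ} (hp : p ∈ PP)
    (hpR : ‖p‖ ≤ R) (h0 : depth p = 0 ∨ (p.1, p.2.1) = 0) : majorant β τ R p = ⊤ := by
  refine top_le_iff.1 (le_trans ?_ (cutPow_mul_le_majorant p))
  rw [cutPow_of_norm_le β (norm_horizontal_le hpR), cutPow_of_norm_le τ (norm_depth_le hp hpR),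
    top_le_iff]
  rcases h0 with h0 | h0
  · rw [h0, enorm_zero, ENNReal.zero_rpow_of_neg (by linarith)]
    exact ENNReal.mul_top (enorm_rpow_neg_ne_zero hβ.le _)
  · rw [h0, enorm_zero, ENNReal.zero_rpow_of_neg (by linarith)]
    exact ENNReal.top_mul (enorm_rpow_neg_ne_zero hτ.le _)

lemma one_div_pow_three_mul_rpow_le {t w ρ a σ : ℝ} (hw : 0 < w) (hwt : w ≤ t ^ 2) (hρ : 0 < ρ)
    (hρt : ρ ≤ t) (ha0 : 0 ≤ a) (ha : a ≤ 3 / 2) :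
    1 / t ^ 3 * w ^ (-σ) ≤ ρ ^ (-(3 - 2 * a)) * w ^ (-(a + σ)) := by
  have ht : 0 < t := hρ.trans_le hρt
  have h1 : 1 / t ^ 3 = t ^ (-(3 - 2 * a)) * (t ^ 2) ^ (-a) := by
    rw [← Real.rpow_natCast t 2, ← Real.rpow_mul ht.le, ← Real.rpow_add ht, one_div,
      ← Real.rpow_natCast t 3, ← Real.rpow_neg ht.le]
    congr 1
    push_cast
    ring
  rw [h1, neg_add, Real.rpow_add hw, ← mul_assoc]
  have h2 := Real.rpow_le_rpow_of_nonpos hρ hρt (by linarith : -(3 - 2 * a) ≤ 0)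
  have h3 := Real.rpow_le_rpow_of_nonpos hw hwt (by linarith : -a ≤ 0)
  gcongr

lemma ofReal_weight_le_majorant {p : ℝ × ℝ × ℝ} {R a σ : ℝ} (ha0 : 0 < a) (ha : a < 3 / 2)
    (hσ : 0 ≤ σ) (hpR : ‖p‖ ≤ R) (hw : p ∈ PP → 0 < depth p) :
    ENNReal.ofReal (weight σ p) ≤ majorant (3 - 2 * a) (a + σ) R p := by
  by_cases hp : p ∈ PP
  · by_cases h0 : ((p.1, p.2.1) : ℝ × ℝ) = 0
    · rw [majorant_eq_top (by linarith) (by linarith) hp hpR (Or.inr h0)]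
      exact le_top
    · have hρ : 0 < ‖((p.1, p.2.1) : ℝ × ℝ)‖ := norm_pos_iff.2 h0
      have hw := hw hp
      refine le_trans ?_ (cutPow_mul_le_majorant p)
      rw [cutPow_of_norm_le _ (norm_horizontal_le hpR), cutPow_of_norm_le _ (norm_depth_le hp hpR),
        weight, if_pos hp, ← ofReal_norm, ← ofReal_norm, Real.norm_of_nonneg hw.le,
        ENNReal.ofReal_rpow_of_pos hρ, ENNReal.ofReal_rpow_of_pos hw,
        ← ENNReal.ofReal_mul (by positivity)]
      refine ENNReal.ofReal_le_ofReal
        (one_div_pow_three_mul_rpow_le hw ?_ hρ ?_ ha0.le ha.le)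
      · rw [Real.sq_sqrt (abs_nonneg _)]
        exact depth_le p
      · exact max_le (abs_le_sqrt_of_mem_PP hp).1 (abs_le_sqrt_of_mem_PP hp).2
  · simp [weight, hp]

lemma ofReal_div_le_majorant {p q : ℝ × ℝ × ℝ} {R s σ a : ℝ} (hR : 1 ≤ R) (hs : 0 < s)
    (hσ0 : 0 ≤ σ) (hσ1 : σ ≤ 1) (ha0 : 0 < a) (ha : a < 3 / 2) (hpR : ‖p‖ ≤ R) (hqR : ‖q‖ ≤ R) :
    ENNReal.ofReal (‖bb p - bb q‖ / ‖p - q‖ ^ (3 + s)) ≤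
      ENNReal.ofReal (20 * R ^ 2) *
        ((majorant (3 - 2 * a) (a + σ) R p + majorant (3 - 2 * a) (a + σ) R q) *
          cutPow (3 + s - σ) (2 * R) (p - q)) := by
  rcases eq_or_ne p q with rfl | hpq
  · simp
  have hd0 : 0 < ‖p - q‖ := norm_pos_iff.2 (sub_ne_zero.2 hpq)
  have hC : ENNReal.ofReal (20 * R ^ 2) ≠ 0 := by
    rw [Ne, ENNReal.ofReal_eq_zero, not_le]
    positivity
  rw [cutPow_of_norm_le (x := p - q) _ (by linarith [norm_sub_le p q])]
  have hE : ‖p - q‖ₑ ^ (-(3 + s - σ)) ≠ 0 := enorm_rpow_neg_ne_zero (by linarith) _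
  by_cases hp : p ∈ PP → 0 < depth p
  · by_cases hq : q ∈ PP → 0 < depth q
    · have hgp := weight_nonneg σ p
      have hgq := weight_nonneg σ q
      calc ENNReal.ofReal (‖bb p - bb q‖ / ‖p - q‖ ^ (3 + s))
          ≤ ENNReal.ofReal (20 * R ^ 2 *
              ((weight σ p + weight σ q) * ‖p - q‖ ^ (-(3 + s - σ)))) := by
            refine ENNReal.ofReal_le_ofReal ?_
            rw [div_le_iff₀ (by positivity), mul_assoc _ (_ * _), mul_assoc (weight σ p + _),
              ← Real.rpow_add hd0]
            refine (norm_bb_sub_le_weight_add hR hσ0 hσ1 hp hq hpR hqR hpq).trans_eq ?_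
            rw [mul_assoc]
            congr 3
            ring
        _ = ENNReal.ofReal (20 * R ^ 2) *
              ((ENNReal.ofReal (weight σ p) + ENNReal.ofReal (weight σ q)) *
                ‖p - q‖ₑ ^ (-(3 + s - σ))) := by
            rw [ENNReal.ofReal_mul (p := 20 * R ^ 2) (by positivity),
              ENNReal.ofReal_mul (p := _ + _) (by positivity),
              ENNReal.ofReal_add hgp hgq, ← ofReal_norm, ENNReal.ofReal_rpow_of_pos hd0]
        _ ≤ _ := by
            gcongr
            · exact ofReal_weight_le_majorant ha0 ha hσ0 hpR hp
            · exact ofReal_weight_le_majorant ha0 ha hσ0 hqR hq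
    · push Not at hq
      rw [majorant_eq_top (p := q) (by linarith) (by linarith) hq.1 hqR
        (Or.inl (hq.2.antisymm (depth_nonneg hq.1))), add_top, ENNReal.top_mul hE,
        ENNReal.mul_top hC]
      exact le_top
  · push Not at hp
    rw [majorant_eq_top (p := p) (by linarith) (by linarith) hp.1 hpR
      (Or.inl (hp.2.antisymm (depth_nonneg hp.1))), top_add, ENNReal.top_mul hE,
      ENNReal.mul_top hC]
    exact le_top

lemma lintegral_cutPow_lt_top {E : Type*} [NormedAddCommGroup E] [NormedSpace ℝ E]
    [FiniteDimensional ℝ E] [Nontrivial E] [MeasurableSpace E] [BorelSpace E]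
    (μ : Measure E) [μ.IsAddHaarMeasure] {β : ℝ} (hβ : β < Module.finrank ℝ E) (R : ℝ) :
    ∫⁻ x : E, cutPow β R x ∂μ < ⊤ := by
  unfold cutPow
  rw [lintegral_indicator Metric.isClosed_closedBall.measurableSet]
  exact lintegral_closedBall_enorm_rpow_lt_top μ hβ R

lemma lintegral_majorant_lt_top {β τ : ℝ} (hβ : β < 2) (hτ : τ < 1) (R : ℝ) :
    ∫⁻ p, majorant β τ R p < ⊤ := by
  have hmaj := measurable_majorant β τ R
  have h1 := measurable_cutPow (E := ℝ × ℝ) β R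
  have h2 := measurable_cutPow (E := ℝ) τ R
  have hfin1 : ∫⁻ x : ℝ × ℝ, cutPow β R x < ⊤ :=
    lintegral_cutPow_lt_top volume (by simpa using hβ) R
  have hfin2 : ∫⁻ x : ℝ, cutPow τ R x < ⊤ :=
    lintegral_cutPow_lt_top volume (by simpa using hτ) R
  have hvert : ∀ c : ℝ, ∫⁻ z : ℝ, (cutPow τ R (z - c) + cutPow τ R (-z - c))
      = 2 * ∫⁻ z : ℝ, cutPow τ R z := by
    intro c
    rw [lintegral_add_left (by fun_prop), lintegral_sub_right_eq_self (cutPow τ R) c,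
      lintegral_neg_eq_self (fun z : ℝ => cutPow τ R (z - c)),
      lintegral_sub_right_eq_self (cutPow τ R) c, two_mul]
  have hcalc : ∫⁻ p, majorant β τ R p
      = (∫⁻ x : ℝ × ℝ, cutPow β R x) * (2 * ∫⁻ z : ℝ, cutPow τ R z) := by
    rw [← lintegral_mul_const _ h1, Measure.volume_eq_prod ℝ (ℝ × ℝ),
      lintegral_prod _ hmaj.aemeasurable, Measure.volume_eq_prod ℝ ℝ,
      lintegral_prod _ (by fun_prop)]
    refine lintegral_congr fun x => ?_
    rw [lintegral_prod _ (by fun_prop)]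
    refine lintegral_congr fun y => ?_
    simp only [majorant]
    rw [lintegral_const_mul _ (by fun_prop), hvert]
  rw [hcalc]
  exact ENNReal.mul_lt_top hfin1 (ENNReal.mul_lt_top (by simp) hfin2)

lemma lintegral_add_mul_sub {E : Type*} [NormedAddCommGroup E] [MeasurableSpace E] [BorelSpace E]
    [SecondCountableTopology E] (μ : Measure E) [SFinite μ] [μ.IsAddLeftInvariant]
    [μ.IsNegInvariant] {f g : E → ℝ≥0∞} (hf : Measurable f) (hg : Measurable g) :
    ∫⁻ q : E × E, (f q.1 + f q.2) * g (q.1 - q.2) ∂(μ.prod μ)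
      = 2 * ((∫⁻ x, f x ∂μ) * ∫⁻ x, g x ∂μ) := by
  simp only [add_mul]
  rw [lintegral_add_left (by fun_prop), lintegral_prod _ (by fun_prop),
    lintegral_prod_symm _ (by fun_prop), two_mul, ← lintegral_mul_const _ hf]
  congr 1
  · refine lintegral_congr fun x => ?_
    dsimp only
    rw [lintegral_const_mul _ (by fun_prop), lintegral_sub_left_eq_self g x]
  · refine lintegral_congr fun x => ?_
    dsimp only
    rw [lintegral_const_mul _ (by fun_prop), lintegral_sub_right_eq_self g x]

/-- The vector field `b` belongs to `W^{s,1}_loc(ℝ³;ℝ³)` for every `0 < s < 1/2`: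
for every such `s` and every compact `K ⊆ ℝ³` the Gagliardo seminorm
`∬_{K×K} |b(x) − b(y)| / |x − y|^{3+s} dx dy` is finite. -/
theorem bb_mem_Ws1_loc :
    ∀ s : ℝ, 0 < s → s < 1 / 2 →
      ∀ K : Set (ℝ × ℝ × ℝ), IsCompact K →
        ∫⁻ q in K ×ˢ K,
            ENNReal.ofReal (‖bb q.1 - bb q.2‖ / ‖q.1 - q.2‖ ^ (3 + s)) ∂volume < ⊤ := by
  intro s hs0 hs K hK
  obtain ⟨R, hKR⟩ := hK.isBounded.exists_norm_le
  obtain ⟨R, hR, hKR⟩ : ∃ R : ℝ, 1 ≤ R ∧ ∀ p ∈ K, ‖p‖ ≤ R :=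
    ⟨max 1 R, le_max_left _ _, fun p hp => (hKR p hp).trans (le_max_right _ _)⟩
  obtain ⟨σ, hsσ, hσ⟩ := exists_between hs
  obtain ⟨a, ha, haσ⟩ := exists_between (by linarith : (1 / 2 : ℝ) < 1 - σ)
  have hmaj := lintegral_majorant_lt_top (β := 3 - 2 * a) (τ := a + σ) (by linarith)
    (by linarith) R
  have hhaar : (volume : Measure (ℝ × ℝ × ℝ)).IsAddHaarMeasure :=
    Measure.prod.instIsAddHaarMeasure volume volume
  have hcut : ∫⁻ x : ℝ × ℝ × ℝ, cutPow (3 + s - σ) (2 * R) x < ⊤ := by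
    refine lintegral_cutPow_lt_top volume ?_ (2 * R)
    simp
    linarith
  calc ∫⁻ q in K ×ˢ K, ENNReal.ofReal (‖bb q.1 - bb q.2‖ / ‖q.1 - q.2‖ ^ (3 + s))
      ≤ ∫⁻ q in K ×ˢ K, ENNReal.ofReal (20 * R ^ 2) *
          ((majorant (3 - 2 * a) (a + σ) R q.1 + majorant (3 - 2 * a) (a + σ) R q.2) *
            cutPow (3 + s - σ) (2 * R) (q.1 - q.2)) :=
        setLIntegral_mono' (hK.measurableSet.prod hK.measurableSet) fun q hq =>
          ofReal_div_le_majorant hR hs0 (by linarith) (by linarith) (by linarith) (by linarith)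
            (hKR _ hq.1) (hKR _ hq.2)
    _ ≤ ∫⁻ q : (ℝ × ℝ × ℝ) × (ℝ × ℝ × ℝ), ENNReal.ofReal (20 * R ^ 2) *
          ((majorant (3 - 2 * a) (a + σ) R q.1 + majorant (3 - 2 * a) (a + σ) R q.2) *
            cutPow (3 + s - σ) (2 * R) (q.1 - q.2)) := setLIntegral_le_lintegral _ _
    _ < ⊤ := by
        have h1 := measurable_majorant (3 - 2 * a) (a + σ) R
        have h2 := measurable_cutPow (E := ℝ × ℝ × ℝ) (3 + s - σ) (2 * R)
        rw [lintegral_const_mul _ (by fun_prop), Measure.volume_eq_prod (ℝ × ℝ × ℝ) (ℝ × ℝ × ℝ),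
          lintegral_add_mul_sub volume h1 h2]
        exact ENNReal.mul_lt_top ENNReal.ofReal_lt_top
          (ENNReal.mul_lt_top (by simp) (ENNReal.mul_lt_top hmaj hcut))

end
end

section
/- For every Θ ∈ (0,2π] and every t ≥ 0, the map X^Θ(t,·) : ℝ³ \ {0} → ℝ³ preserves three-dimensional Lebesgue measure: the push-forward of Lebesgue measure on ℝ³ under X^Θ(t,·) equals Lebesgue measure, i.e. 𝓛³((X^Θ(t,·))⁻¹(A)) = 𝓛³(A) for every Borel set A ⊆ ℝ³. In particular X^Θ is a regular Lagrangian flow of b with compressibility constant L = 1. -/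
open MeasureTheory Real Set Filter Topology
open scoped ENNReal

noncomputable section

open scoped Classical in
/-- The flow `X^Θ` of `b`: identity outside `P`; the explicit solution on `P⁻`;
on `P⁺` the trajectory falls to the origin at time `z²/4` and then continues into `P⁻`
rotated by the angle `Θ` in the `xy`-plane. -/
def XTheta (Θ : ℝ) (t : ℝ) (p : ℝ × ℝ × ℝ) : ℝ × ℝ × ℝ :=
  let x := p.1; let y := p.2.1; let z := p.2.2
  if x ^ 2 + y ^ 2 ≤ -z ∧ z < 0 then
    (x / Real.sqrt (-z) * (z ^ 2 + 4 * t) ^ ((1 : ℝ) / 4),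
     y / Real.sqrt (-z) * (z ^ 2 + 4 * t) ^ ((1 : ℝ) / 4),
     -Real.sqrt (z ^ 2 + 4 * t))
  else if x ^ 2 + y ^ 2 ≤ z ∧ 0 < z then
    if t ≤ z ^ 2 / 4 then
      (x / Real.sqrt z * (z ^ 2 - 4 * t) ^ ((1 : ℝ) / 4),
       y / Real.sqrt z * (z ^ 2 - 4 * t) ^ ((1 : ℝ) / 4),
       Real.sqrt (z ^ 2 - 4 * t))
    else
      ((x * Real.cos Θ - y * Real.sin Θ) / Real.sqrt z * (4 * t - z ^ 2) ^ ((1 : ℝ) / 4),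
       (x * Real.sin Θ + y * Real.cos Θ) / Real.sqrt z * (4 * t - z ^ 2) ^ ((1 : ℝ) / 4),
       -Real.sqrt (4 * t - z ^ 2))
  else p

/-- The inverse of `z ↦ z * |z|`, that is, `sgn w · √|w|`. -/
def signedSqrt (w : ℝ) : ℝ := √w - √(-w)

/-- The function equal to `a · w ^ (1/4)` for `0 ≤ w` and to `b · (-w) ^ (1/4)` for `w ≤ 0`. -/
def quarticGlue (a b w : ℝ) : ℝ := a * √(√w) + b * √(√(-w))

/-- The derivative of `w ↦ √√w` away from `0`. -/
def quarticDeriv (w : ℝ) : ℝ := (4 * √(√w) * √w)⁻¹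

/-- The derivative of `w ↦ √w` away from `0`. -/
def sqrtDeriv (w : ℝ) : ℝ := (2 * √w)⁻¹

lemma signedSqrt_of_nonneg {w : ℝ} (hw : 0 ≤ w) : signedSqrt w = √w := by
  simp [signedSqrt, sqrt_eq_zero_of_nonpos (neg_nonpos.2 hw)]

lemma signedSqrt_of_nonpos {w : ℝ} (hw : w ≤ 0) : signedSqrt w = -√(-w) := by
  simp [signedSqrt, sqrt_eq_zero_of_nonpos hw]

lemma abs_signedSqrt (w : ℝ) : |signedSqrt w| = √|w| := by
  rcases le_total 0 w with hw | hw
  · rw [signedSqrt_of_nonneg hw, abs_of_nonneg hw, abs_of_nonneg (sqrt_nonneg _)]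
  · rw [signedSqrt_of_nonpos hw, abs_of_nonpos hw, abs_neg, abs_of_nonneg (sqrt_nonneg _)]

lemma signedSqrt_mul_abs_self (z : ℝ) : signedSqrt (z * |z|) = z := by
  rcases le_total 0 z with hz | hz
  · rw [abs_of_nonneg hz, signedSqrt_of_nonneg (by positivity), sqrt_mul_self hz]
  · rw [abs_of_nonpos hz, signedSqrt_of_nonpos (by nlinarith),
      show -(z * -z) = (-z) * (-z) by ring, sqrt_mul_self (by linarith), neg_neg]

lemma signedSqrt_mul_abs_signedSqrt (w : ℝ) : signedSqrt w * |signedSqrt w| = w := by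
  rw [abs_signedSqrt]
  rcases le_total 0 w with hw | hw
  · rw [signedSqrt_of_nonneg hw, abs_of_nonneg hw, mul_self_sqrt hw]
  · rw [signedSqrt_of_nonpos hw, abs_of_nonpos hw, neg_mul, mul_self_sqrt (by linarith), neg_neg]

lemma quarticGlue_of_nonneg (a b : ℝ) {w : ℝ} (hw : 0 ≤ w) :
    quarticGlue a b w = a * √(√w) := by
  simp [quarticGlue, sqrt_eq_zero_of_nonpos (neg_nonpos.2 hw)]

lemma quarticGlue_of_nonpos (a b : ℝ) {w : ℝ} (hw : w ≤ 0) :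
    quarticGlue a b w = b * √(√(-w)) := by
  simp [quarticGlue, sqrt_eq_zero_of_nonpos hw]

lemma rpow_one_fourth_eq_sqrt_sqrt {w : ℝ} (hw : 0 ≤ w) : w ^ ((1 : ℝ) / 4) = √(√w) := by
  rw [sqrt_eq_rpow, sqrt_eq_rpow, ← rpow_mul hw]
  norm_num

/-- The angle by which the flow has rotated the points of height `z` once they are in `P⁻`. -/
def exitAngle (Θ z : ℝ) : ℝ := if 0 < z then Θ else 0

lemma XTheta_of_mem (Θ : ℝ) {t : ℝ} (ht : 0 ≤ t) {x y z : ℝ} (hz : z ≠ 0)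
    (h : x ^ 2 + y ^ 2 ≤ |z|) :
    XTheta Θ t (x, y, z) =
      (quarticGlue (x / √|z|)
        ((x * cos (exitAngle Θ z) - y * sin (exitAngle Θ z)) / √|z|) (z * |z| - 4 * t),
       quarticGlue (y / √|z|)
        ((x * sin (exitAngle Θ z) + y * cos (exitAngle Θ z)) / √|z|) (z * |z| - 4 * t),
       signedSqrt (z * |z| - 4 * t)) := by
  rcases lt_or_gt_of_ne hz with hz | hz
  · rw [abs_of_neg hz] at h ⊢
    have hw : z * -z - 4 * t ≤ 0 := by nlinarith
    have hw' : z ^ 2 + 4 * t = -(z * -z - 4 * t) := by ring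
    simp only [XTheta, exitAngle]
    rw [if_pos ⟨h, hz⟩, if_neg hz.not_gt, quarticGlue_of_nonpos _ _ hw,
      quarticGlue_of_nonpos _ _ hw, signedSqrt_of_nonpos hw,
      rpow_one_fourth_eq_sqrt_sqrt (by positivity), hw']
    simp
  · rw [abs_of_pos hz] at h ⊢
    simp only [XTheta, exitAngle]
    rw [if_neg (fun h' => hz.not_gt h'.2), if_pos ⟨h, hz⟩, if_pos hz]
    split_ifs with ht'
    · have hw : 0 ≤ z * z - 4 * t := by nlinarith
      have hw' : z ^ 2 - 4 * t = z * z - 4 * t := by ring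
      rw [hw', quarticGlue_of_nonneg _ _ hw, quarticGlue_of_nonneg _ _ hw,
        signedSqrt_of_nonneg hw, rpow_one_fourth_eq_sqrt_sqrt hw]
    · have hw : z * z - 4 * t ≤ 0 := by nlinarith
      have hw' : 4 * t - z ^ 2 = -(z * z - 4 * t) := by ring
      rw [hw', quarticGlue_of_nonpos _ _ hw, quarticGlue_of_nonpos _ _ hw,
        signedSqrt_of_nonpos hw, rpow_one_fourth_eq_sqrt_sqrt (by linarith)]

lemma XTheta_of_notMem (Θ t : ℝ) {x y z : ℝ} (h : z = 0 ∨ |z| < x ^ 2 + y ^ 2) :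
    XTheta Θ t (x, y, z) = (x, y, z) := by
  simp only [XTheta]
  rw [if_neg, if_neg]
  · rintro ⟨h1, h2⟩
    rw [abs_of_pos h2] at h
    rcases h with h | h <;> linarith
  · rintro ⟨h1, h2⟩
    rw [abs_of_neg h2] at h
    rcases h with h | h <;> linarith

lemma mem_PP {x y z : ℝ} : (x, y, z) ∈ PP ↔ x ^ 2 + y ^ 2 ≤ |z| := by
  simp [PP, Pplus, Pminus, le_abs]

lemma quarticGlue_sq_add_sq_le {x y c w φ : ℝ} (hc : 0 < c) (h : x ^ 2 + y ^ 2 ≤ c) :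
    quarticGlue (x / √c) ((x * cos φ - y * sin φ) / √c) w ^ 2 +
      quarticGlue (y / √c) ((x * sin φ + y * cos φ) / √c) w ^ 2 ≤ √|w| := by
  have hc' : √c ^ 2 = c := sq_sqrt hc.le
  rcases le_total 0 w with hw | hw
  · rw [quarticGlue_of_nonneg _ _ hw, quarticGlue_of_nonneg _ _ hw, abs_of_nonneg hw, mul_pow,
      mul_pow, div_pow, div_pow, hc', sq_sqrt (sqrt_nonneg _), ← add_mul, ← add_div]
    exact mul_le_of_le_one_left (sqrt_nonneg _) ((div_le_one hc).2 h)
  · rw [quarticGlue_of_nonpos _ _ hw, quarticGlue_of_nonpos _ _ hw, abs_of_nonpos hw, mul_pow,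
      mul_pow, div_pow, div_pow, hc', sq_sqrt (sqrt_nonneg _), ← add_mul, ← add_div]
    refine mul_le_of_le_one_left (sqrt_nonneg _) ((div_le_one hc).2 ?_)
    linear_combination h + (x ^ 2 + y ^ 2) * sin_sq_add_cos_sq φ

lemma bb_of_le {x x' y y' w : ℝ}
    (h : quarticGlue x x' w ^ 2 + quarticGlue y y' w ^ 2 ≤ √|w|) :
    bb (quarticGlue x x' w, quarticGlue y y' w, signedSqrt w) =
      (-4 * (x * quarticDeriv w - x' * quarticDeriv (-w)),
       -4 * (y * quarticDeriv w - y' * quarticDeriv (-w)),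
       -4 * (sqrtDeriv w + sqrtDeriv (-w))) := by
  rw [← abs_signedSqrt, ← mem_PP] at h
  rcases lt_trichotomy w 0 with hw | rfl | hw
  · have hs : signedSqrt w < 0 := by
      rw [signedSqrt_of_nonpos hw.le]; simpa using hw
    have hr : 0 < √(√(-w)) := by simpa using hw
    rw [bb, if_pos ⟨h, hs.ne⟩]
    rw [sign_of_neg hs, abs_of_neg hs]
    simp only [quarticGlue_of_nonpos _ _ hw.le,
      signedSqrt_of_nonpos hw.le, quarticDeriv, sqrtDeriv, sqrt_eq_zero_of_nonpos hw.le]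
    rw [← sq_sqrt (sqrt_nonneg (-w))]
    simp only [sqrt_sq hr.le]
    generalize √(√(-w)) = r at hr
    refine Prod.ext ?_ (Prod.ext ?_ ?_) <;> simp <;> field_simp <;> norm_num
  · simp [bb, signedSqrt, quarticDeriv, sqrtDeriv]
  · have hs : 0 < signedSqrt w := by
      rw [signedSqrt_of_nonneg hw.le]; simpa using hw
    have hr : 0 < √(√w) := by simpa using hw
    rw [bb, if_pos ⟨h, hs.ne'⟩]
    rw [sign_of_pos hs, abs_of_pos hs]
    simp only [quarticGlue_of_nonneg _ _ hw.le,
      signedSqrt_of_nonneg hw.le, quarticDeriv, sqrtDeriv,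
      sqrt_eq_zero_of_nonpos (neg_nonpos.2 hw.le)]
    rw [← sq_sqrt (sqrt_nonneg w)]
    simp only [sqrt_sq hr.le]
    generalize √(√w) = r at hr
    refine Prod.ext ?_ (Prod.ext ?_ ?_) <;> simp <;> field_simp <;> norm_num

lemma hasDerivAt_sqrt_sqrtDeriv {w : ℝ} (hw : w ≠ 0) :
    HasDerivAt (fun w => √w) (sqrtDeriv w) w := by
  simpa [sqrtDeriv] using Real.hasDerivAt_sqrt hw

lemma hasDerivAt_sqrt_sqrt {w : ℝ} (hw : w ≠ 0) :
    HasDerivAt (fun w => √(√w)) (quarticDeriv w) w := by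
  rcases lt_or_gt_of_ne hw with hw | hw
  · rw [quarticDeriv, sqrt_eq_zero_of_nonpos hw.le]
    refine (hasDerivAt_const w (0 : ℝ)).congr_of_eventuallyEq ?_ |>.congr_deriv (by simp)
    filter_upwards [eventually_lt_nhds hw] with v hv
    simp [sqrt_eq_zero_of_nonpos hv.le]
  · refine ((Real.hasDerivAt_sqrt hw.ne').sqrt (sqrt_pos.2 hw).ne').congr_deriv ?_
    rw [quarticDeriv]
    field_simp
    norm_num

lemma intervalIntegrable_quarticDeriv (a b : ℝ) : IntervalIntegrable quarticDeriv volume a b := by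
  have h : IntervalIntegrable (fun x : ℝ => 4⁻¹ * x ^ (-3 / 4 : ℝ)) volume a b :=
    (intervalIntegral.intervalIntegrable_rpow' (by norm_num)).const_mul _
  rw [intervalIntegrable_iff] at h ⊢
  refine (h.indicator (measurableSet_Ioi (a := (0 : ℝ)))).congr (ae_of_all _ fun w => ?_)
  rcases le_or_gt w 0 with hw | hw
  · simp [quarticDeriv, sqrt_eq_zero_of_nonpos hw, hw]
  · rw [indicator_of_mem (mem_Ioi.2 hw), quarticDeriv, mul_assoc, mul_inv, sqrt_eq_rpow,
      sqrt_eq_rpow, ← rpow_mul hw.le, ← rpow_add hw, ← rpow_neg hw.le]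
    norm_num

lemma intervalIntegrable_sqrtDeriv (a b : ℝ) : IntervalIntegrable sqrtDeriv volume a b := by
  have h : IntervalIntegrable (fun x : ℝ => 2⁻¹ * x ^ (-1 / 2 : ℝ)) volume a b :=
    (intervalIntegral.intervalIntegrable_rpow' (by norm_num)).const_mul _
  rw [intervalIntegrable_iff] at h ⊢
  refine (h.indicator (measurableSet_Ioi (a := (0 : ℝ)))).congr (ae_of_all _ fun w => ?_)
  rcases le_or_gt w 0 with hw | hw
  · simp [sqrtDeriv, sqrt_eq_zero_of_nonpos hw, hw]
  · rw [indicator_of_mem (mem_Ioi.2 hw), sqrtDeriv, mul_inv, sqrt_eq_rpow, ← rpow_neg hw.le]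
    norm_num

lemma intervalIntegrable_comp_affine {f : ℝ → ℝ}
    (hf : ∀ a b, IntervalIntegrable f volume a b) {m : ℝ} (hm : m ≠ 0) (c a b : ℝ) :
    IntervalIntegrable (fun s => f (c + m * s)) volume a b := by
  have h := ((hf (c + m * a) (c + m * b)).comp_add_left c).comp_mul_left (c := m)
  simpa [hm] using h

lemma hasDerivAt_quarticGlue (a b : ℝ) {w : ℝ} (hw : w ≠ 0) :
    HasDerivAt (quarticGlue a b) (a * quarticDeriv w - b * quarticDeriv (-w)) w := by
  have h := ((hasDerivAt_sqrt_sqrt hw).const_mul a).add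
    (((hasDerivAt_sqrt_sqrt (neg_ne_zero.2 hw)).comp w (hasDerivAt_neg w)).const_mul b)
  exact h.congr_deriv (by ring)

lemma hasDerivAt_signedSqrt {w : ℝ} (hw : w ≠ 0) :
    HasDerivAt signedSqrt (sqrtDeriv w + sqrtDeriv (-w)) w := by
  have h := (hasDerivAt_sqrt_sqrtDeriv hw).sub
    ((hasDerivAt_sqrt_sqrtDeriv (neg_ne_zero.2 hw)).comp w (hasDerivAt_neg w))
  exact h.congr_deriv (by ring)

lemma continuous_quarticGlue (a b : ℝ) : Continuous (quarticGlue a b) := by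
  unfold quarticGlue; fun_prop

lemma continuous_signedSqrt : Continuous signedSqrt := by
  unfold signedSqrt; fun_prop

lemma quarticGlue_mul_abs_self (Θ x : ℝ) {y z : ℝ} (hz : z ≠ 0) :
    quarticGlue (x / √|z|) ((x * cos (exitAngle Θ z) - y * sin (exitAngle Θ z)) / √|z|)
      (z * |z|) = x ∧
    quarticGlue (x / √|z|) ((y * sin (exitAngle Θ z) + x * cos (exitAngle Θ z)) / √|z|)
      (z * |z|) = x := by
  have h : √|z| ≠ 0 := by simpa using hz
  rcases lt_or_gt_of_ne hz with hz | hz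
  · have hw : z * |z| ≤ 0 := by nlinarith [abs_nonneg z]
    have hw' : -(z * |z|) = |z| * |z| := by rw [abs_of_neg hz]; ring
    rw [quarticGlue_of_nonpos _ _ hw, quarticGlue_of_nonpos _ _ hw, hw',
      sqrt_mul_self (abs_nonneg z)]
    simp [exitAngle, hz.not_gt, h]
  · have hw' : z * |z| = |z| * |z| := by rw [abs_of_pos hz]
    rw [hw', quarticGlue_of_nonneg _ _ (by positivity), quarticGlue_of_nonneg _ _ (by positivity),
      sqrt_mul_self (abs_nonneg z)]
    simp [h]

/-- The trajectories of `XTheta` are integral curves of `bb`. -/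
lemma XTheta_integral_curve (Θ : ℝ) {t : ℝ} (ht : 0 ≤ t) (p : ℝ × ℝ × ℝ) :
    IntegrableOn (fun s => bb (XTheta Θ s p)) (Icc 0 t) volume ∧
      XTheta Θ t p = p + ∫ s in (0 : ℝ)..t, bb (XTheta Θ s p) := by
  obtain ⟨x, y, z⟩ := p
  by_cases h : z = 0 ∨ |z| < x ^ 2 + y ^ 2
  · have hb : bb (x, y, z) = 0 := by
      rw [bb, if_neg]
      · rfl
      · rintro ⟨h1, h2⟩
        rw [mem_PP] at h1
        exact h.elim h2 h1.not_gt
    simp [XTheta_of_notMem _ _ h, hb]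
  push Not at h
  obtain ⟨hz, h⟩ := h
  set x' := (x * cos (exitAngle Θ z) - y * sin (exitAngle Θ z)) / √|z|
  set y' := (x * sin (exitAngle Θ z) + y * cos (exitAngle Θ z)) / √|z|
  let F : ℝ → ℝ × ℝ × ℝ := fun w =>
    (quarticGlue (x / √|z|) x' w, quarticGlue (y / √|z|) y' w, signedSqrt w)
  let D : ℝ → ℝ × ℝ × ℝ := fun w =>
    (-4 * (x / √|z| * quarticDeriv w - x' * quarticDeriv (-w)),
      -4 * (y / √|z| * quarticDeriv w - y' * quarticDeriv (-w)),
      -4 * (sqrtDeriv w + sqrtDeriv (-w)))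
  have hX : ∀ s, 0 ≤ s → XTheta Θ s (x, y, z) = F (z * |z| + -4 * s) := fun s hs => by
    rw [XTheta_of_mem Θ hs hz h, neg_mul, ← sub_eq_add_neg]
  have hbX : ∀ s, 0 ≤ s → bb (XTheta Θ s (x, y, z)) = D (z * |z| + -4 * s) := fun s hs => by
    rw [hX s hs]
    exact bb_of_le (quarticGlue_sq_add_sq_le (abs_pos.2 hz) h)
  have hF0 : F (z * |z| + -4 * 0) = (x, y, z) := by
    simp only [F, mul_zero, add_zero, signedSqrt_mul_abs_self]
    rw [(quarticGlue_mul_abs_self Θ x hz).1, (quarticGlue_mul_abs_self Θ y hz).2]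
  have hq := intervalIntegrable_comp_affine intervalIntegrable_quarticDeriv
    (by norm_num : (-4 : ℝ) ≠ 0) (z * |z|) 0 t
  have hq' := intervalIntegrable_comp_affine intervalIntegrable_quarticDeriv
    (by norm_num : (4 : ℝ) ≠ 0) (-(z * |z|)) 0 t
  have hs := intervalIntegrable_comp_affine intervalIntegrable_sqrtDeriv
    (by norm_num : (-4 : ℝ) ≠ 0) (z * |z|) 0 t
  have hs' := intervalIntegrable_comp_affine intervalIntegrable_sqrtDeriv
    (by norm_num : (4 : ℝ) ≠ 0) (-(z * |z|)) 0 t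
  have hneg : ∀ s, -(z * |z|) + 4 * s = -(z * |z| + -4 * s) := fun s => by ring
  simp only [hneg] at hq' hs'
  have hD : IntegrableOn (fun s => D (z * |z| + -4 * s)) (Ioc 0 t) volume := by
    rw [intervalIntegrable_iff_integrableOn_Ioc_of_le ht] at hq hq' hs hs'
    exact (((hq.const_mul _).sub (hq'.const_mul _)).const_mul _).prodMk
      ((((hq.const_mul _).sub (hq'.const_mul _)).const_mul _).prodMk ((hs.add hs').const_mul _))
  have hbD : IntegrableOn (fun s => bb (XTheta Θ s (x, y, z))) (Icc 0 t) volume := by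
    rw [integrableOn_Icc_iff_integrableOn_Ioc]
    exact hD.congr_fun (fun s hs => (hbX s hs.1.le).symm) measurableSet_Ioc
  refine ⟨hbD, ?_⟩
  have key := integral_eq_of_hasDerivAt_off_countable_of_le
    (fun s => F (z * |z| + -4 * s)) (fun s => D (z * |z| + -4 * s)) ht
    (countable_singleton (z * |z| / 4))
    (((continuous_quarticGlue _ _).prodMk
      ((continuous_quarticGlue _ _).prodMk continuous_signedSqrt)).comp
        (by fun_prop : Continuous fun s => z * |z| + -4 * s)).continuousOn
    (fun s hs => ?_) ((intervalIntegrable_iff_integrableOn_Ioc_of_le ht).2 hD)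
  · rw [intervalIntegral.integral_congr (g := fun s => D (z * |z| + -4 * s))
      (fun s hs => hbX s (by rw [uIcc_of_le ht] at hs; exact hs.1)), key, hX t ht]
    simp only [hF0]
    abel
  · have hw : z * |z| + -4 * s ≠ 0 := fun h0 => hs.2 (by rw [mem_singleton_iff]; linarith)
    have hl : HasDerivAt (fun s => z * |z| + -4 * s) (-4) s := by
      simpa using ((hasDerivAt_id s).const_mul (-4)).const_add (z * |z|)
    have := ((hasDerivAt_quarticGlue (x / √|z|) x' hw).prodMk
      ((hasDerivAt_quarticGlue (y / √|z|) y' hw).prodMk (hasDerivAt_signedSqrt hw))).scomp s hl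
    exact this

lemma measurable_XTheta (Θ t : ℝ) : Measurable (XTheta Θ t) := by
  have h₁ : MeasurableSet {p : ℝ × ℝ × ℝ | p.1 ^ 2 + p.2.1 ^ 2 ≤ -p.2.2} :=
    measurableSet_le (by fun_prop) (by fun_prop)
  have h₂ : MeasurableSet {p : ℝ × ℝ × ℝ | p.2.2 < 0} :=
    measurableSet_lt (by fun_prop) (by fun_prop)
  have h₃ : MeasurableSet {p : ℝ × ℝ × ℝ | p.1 ^ 2 + p.2.1 ^ 2 ≤ p.2.2} :=
    measurableSet_le (by fun_prop) (by fun_prop)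
  have h₄ : MeasurableSet {p : ℝ × ℝ × ℝ | 0 < p.2.2} :=
    measurableSet_lt (by fun_prop) (by fun_prop)
  have h₅ : MeasurableSet {p : ℝ × ℝ × ℝ | t ≤ p.2.2 ^ 2 / 4} :=
    measurableSet_le (by fun_prop) (by fun_prop)
  unfold XTheta
  exact Measurable.ite (h₁.inter h₂) (by fun_prop)
    (Measurable.ite (h₃.inter h₄) (Measurable.ite h₅ (by fun_prop) (by fun_prop)) measurable_id)

/-- Rotation of the plane by the angle `φ` followed by dilation by the factor `c`. -/
def planeSimilarity (c φ : ℝ) (q : ℝ × ℝ) : ℝ × ℝ :=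
  (c * (q.1 * cos φ - q.2 * sin φ), c * (q.1 * sin φ + q.2 * cos φ))

lemma volume_preimage_planeSimilarity {c : ℝ} (hc : c ≠ 0) (φ : ℝ) (S : Set (ℝ × ℝ)) :
    volume (planeSimilarity c φ ⁻¹' S) = ENNReal.ofReal (c ^ 2)⁻¹ * volume S := by
  let L := Matrix.toLin (Module.Basis.finTwoProd ℝ) (Module.Basis.finTwoProd ℝ)
    !![c * cos φ, -(c * sin φ); c * sin φ, c * cos φ]
  have hL : planeSimilarity c φ = L := by
    funext q
    rw [Matrix.toLin_finTwoProd_apply, planeSimilarity]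
    refine Prod.ext ?_ ?_ <;> simp only <;> ring
  have hdet : LinearMap.det L = c ^ 2 := by
    rw [LinearMap.det_toLin, Matrix.det_fin_two_of]
    linear_combination c ^ 2 * sin_sq_add_cos_sq φ
  rw [hL, Measure.addHaar_preimage_linearMap _ (by rw [hdet]; positivity), hdet,
    abs_of_nonneg (by positivity)]

lemma planeSimilarity_sq_add_sq (c φ : ℝ) (q : ℝ × ℝ) :
    (planeSimilarity c φ q).1 ^ 2 + (planeSimilarity c φ q).2 ^ 2 = c ^ 2 * (q.1 ^ 2 + q.2 ^ 2) := by
  simp only [planeSimilarity]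
  linear_combination c ^ 2 * (q.1 ^ 2 + q.2 ^ 2) * sin_sq_add_cos_sq φ

lemma exists_XTheta_eq_planeSimilarity (Θ : ℝ) {t : ℝ} (ht : 0 ≤ t) {z : ℝ} (hz : z ≠ 0) :
    ∃ φ, ∀ q : ℝ × ℝ, q.1 ^ 2 + q.2 ^ 2 ≤ |z| →
      XTheta Θ t (q.1, q.2, z) =
        ((planeSimilarity (√(√|z * |z| - 4 * t|) / √|z|) φ q).1,
          (planeSimilarity (√(√|z * |z| - 4 * t|) / √|z|) φ q).2,
          signedSqrt (z * |z| - 4 * t)) := by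
  rcases le_total 0 (z * |z| - 4 * t) with hw | hw
  · refine ⟨0, fun q hq => ?_⟩
    rw [XTheta_of_mem Θ ht hz hq, quarticGlue_of_nonneg _ _ hw, quarticGlue_of_nonneg _ _ hw,
      abs_of_nonneg hw]
    simp only [planeSimilarity, cos_zero, sin_zero]
    refine Prod.ext ?_ (Prod.ext ?_ rfl) <;> simp only <;> ring
  · refine ⟨exitAngle Θ z, fun q hq => ?_⟩
    rw [XTheta_of_mem Θ ht hz hq, quarticGlue_of_nonpos _ _ hw, quarticGlue_of_nonpos _ _ hw,
      abs_of_nonpos hw]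
    simp only [planeSimilarity]
    refine Prod.ext ?_ (Prod.ext ?_ rfl) <;> simp only <;> ring

lemma hasDerivAt_mul_abs (z : ℝ) : HasDerivAt (fun z => z * |z|) (2 * |z|) z := by
  rcases eq_or_ne z 0 with rfl | hz
  · rw [hasDerivAt_iff_tendsto_slope_zero]
    have : Tendsto (fun h : ℝ => |h|) (𝓝[≠] 0) (𝓝 |0|) :=
      (continuous_abs.tendsto 0).mono_left nhdsWithin_le_nhds
    simp only [abs_zero, mul_zero] at this ⊢
    refine this.congr' ?_
    filter_upwards [self_mem_nhdsWithin] with h hh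
    have : h ≠ 0 := hh
    simp [this]
  · refine ((hasDerivAt_id z).mul (hasDerivAt_abs hz)).congr_deriv ?_
    have := sign_mul_self z
    simp only [id_eq]
    linarith [mul_comm z (SignType.sign z : ℝ)]

lemma lintegral_comp_mul_abs (g : ℝ → ℝ≥0∞) :
    ∫⁻ w, g w = ∫⁻ z, ENNReal.ofReal (2 * |z|) * g (z * |z|) := by
  have h := lintegral_image_eq_lintegral_abs_deriv_mul MeasurableSet.univ
    (fun z _ => (hasDerivAt_mul_abs z).hasDerivWithinAt)
    (Function.LeftInverse.injective signedSqrt_mul_abs_self).injOn g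
  rw [image_univ, (Function.RightInverse.surjective
    signedSqrt_mul_abs_signedSqrt : Function.Surjective fun z : ℝ => z * |z|).range_eq] at h
  simpa [abs_mul] using h

/-- Change of variables along the height component `z ↦ signedSqrt (z * |z| - τ)` of the flow. -/
lemma lintegral_comp_signedSqrt (τ : ℝ) (F : ℝ → ℝ≥0∞) :
    ∫⁻ z, ENNReal.ofReal (|z| / √|z * |z| - τ|) * F (signedSqrt (z * |z| - τ)) = ∫⁻ z, F z := by
  let ψ : ℝ → ℝ≥0∞ := fun w => ENNReal.ofReal (2 * √|w|)⁻¹ * F (signedSqrt w)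
  calc ∫⁻ z, ENNReal.ofReal (|z| / √|z * |z| - τ|) * F (signedSqrt (z * |z| - τ))
      = ∫⁻ z, ENNReal.ofReal (2 * |z|) * ψ (z * |z| - τ) := by
        refine lintegral_congr fun z => ?_
        rw [← mul_assoc, ← ENNReal.ofReal_mul (by positivity)]
        congr 2
        rw [mul_inv]
        ring
    _ = ∫⁻ w, ψ (w - τ) := (lintegral_comp_mul_abs fun w => ψ (w - τ)).symm
    _ = ∫⁻ w, ψ w := lintegral_sub_right_eq_self ψ τ
    _ = ∫⁻ z, ENNReal.ofReal (2 * |z|) * ψ (z * |z|) := lintegral_comp_mul_abs ψ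
    _ = ∫⁻ z, F z := by
        refine lintegral_congr_ae ?_
        filter_upwards [volume.ae_ne (0 : ℝ)] with z hz
        have : 0 < |z| := abs_pos.2 hz
        simp only [ψ]
        rw [signedSqrt_mul_abs_self, abs_mul, abs_abs, sqrt_mul_self this.le, ← mul_assoc,
          ← ENNReal.ofReal_mul (by positivity), mul_inv_cancel₀ (by positivity),
          ENNReal.ofReal_one, one_mul]

lemma volume_eq_lintegral_slices {A : Set (ℝ × ℝ × ℝ)} (hA : MeasurableSet A) :
    volume A = ∫⁻ z, volume {q : ℝ × ℝ | (q.1, q.2, z) ∈ A} := by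
  rw [← (volume_preserving_prodAssoc (α₁ := ℝ) (β₁ := ℝ) (γ₁ := ℝ)).measure_preimage_equiv A,
    Measure.volume_eq_prod, Measure.prod_apply_symm (MeasurableEquiv.measurable _ hA)]
  rfl

/-- The part inside the disc of area `π * |z|` of the slice of `A` at height `z`. -/
def innerSlice (A : Set (ℝ × ℝ × ℝ)) (z : ℝ) : Set (ℝ × ℝ) :=
  {q | (q.1, q.2, z) ∈ A ∧ q.1 ^ 2 + q.2 ^ 2 ≤ |z|}

/-- The part outside the disc of area `π * |z|` of the slice of `A` at height `z`. -/
def outerSlice (A : Set (ℝ × ℝ × ℝ)) (z : ℝ) : Set (ℝ × ℝ) :=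
  {q | (q.1, q.2, z) ∈ A ∧ |z| < q.1 ^ 2 + q.2 ^ 2}

lemma measurable_volume_outerSlice {A : Set (ℝ × ℝ × ℝ)} (hA : MeasurableSet A) :
    Measurable fun z => volume (outerSlice A z) := by
  have h : MeasurableSet {r : (ℝ × ℝ) × ℝ | |r.2| < r.1.1 ^ 2 + r.1.2 ^ 2} :=
    measurableSet_lt (by fun_prop) (by fun_prop)
  exact measurable_measure_prodMk_right ((MeasurableEquiv.prodAssoc.measurable hA).inter h)

lemma volume_slice_eq_add {A : Set (ℝ × ℝ × ℝ)} (z : ℝ) :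
    volume {q : ℝ × ℝ | (q.1, q.2, z) ∈ A} =
      volume (outerSlice A z) + volume (innerSlice A z) := by
  have hm : MeasurableSet {q : ℝ × ℝ | |z| < q.1 ^ 2 + q.2 ^ 2} :=
    measurableSet_lt (by fun_prop) (by fun_prop)
  rw [← measure_inter_add_sdiff _ hm]
  congr 2
  ext q
  simp [innerSlice]

lemma volume_eq_lintegral_outerSlice_add_innerSlice {A : Set (ℝ × ℝ × ℝ)}
    (hA : MeasurableSet A) :
    volume A = (∫⁻ z, volume (outerSlice A z)) + ∫⁻ z, volume (innerSlice A z) := by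
  rw [← lintegral_add_left (measurable_volume_outerSlice hA), volume_eq_lintegral_slices hA]
  exact lintegral_congr volume_slice_eq_add

lemma outerSlice_preimage_XTheta (Θ t : ℝ) (A : Set (ℝ × ℝ × ℝ)) (z : ℝ) :
    outerSlice (XTheta Θ t ⁻¹' A) z = outerSlice A z := by
  ext q
  simp only [outerSlice, mem_ofPred_eq, mem_preimage]
  refine and_congr_left fun h => ?_
  rw [XTheta_of_notMem Θ t (Or.inr h)]

lemma volume_innerSlice_preimage_XTheta (Θ : ℝ) {t : ℝ} (ht : 0 ≤ t) (A : Set (ℝ × ℝ × ℝ))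
    {z : ℝ} (hz : z ≠ 0) (hw : z * |z| - 4 * t ≠ 0) :
    volume (innerSlice (XTheta Θ t ⁻¹' A) z) =
      ENNReal.ofReal (|z| / √|z * |z| - 4 * t|) *
        volume (innerSlice A (signedSqrt (z * |z| - 4 * t))) := by
  obtain ⟨φ, hφ⟩ := exists_XTheta_eq_planeSimilarity Θ ht hz
  set w := z * |z| - 4 * t
  set c := √(√|w|) / √|z| with hc
  have hz' : 0 < |z| := abs_pos.2 hz
  have hw' : 0 < √|w| := sqrt_pos.2 (abs_pos.2 hw)
  have hc2 : c ^ 2 = √|w| / |z| := by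
    rw [hc, div_pow, sq_sqrt hw'.le, sq_sqrt hz'.le]
  have hc0 : c ≠ 0 := by positivity
  have hset : innerSlice (XTheta Θ t ⁻¹' A) z =
      planeSimilarity c φ ⁻¹' innerSlice A (signedSqrt w) := by
    ext q
    simp only [innerSlice, mem_ofPred_eq, mem_preimage, planeSimilarity_sq_add_sq, abs_signedSqrt]
    have hq : c ^ 2 * (q.1 ^ 2 + q.2 ^ 2) ≤ √|w| ↔ q.1 ^ 2 + q.2 ^ 2 ≤ |z| := by
      rw [hc2, div_mul_eq_mul_div, div_le_iff₀ hz', mul_le_mul_iff_right₀ hw']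
    rw [hq]
    refine and_congr_left fun h => ?_
    rw [hφ q h]
  rw [hset, volume_preimage_planeSimilarity hc0, hc2, inv_div]

lemma volume_preimage_XTheta (Θ : ℝ) {t : ℝ} (ht : 0 ≤ t) {A : Set (ℝ × ℝ × ℝ)}
    (hA : MeasurableSet A) : volume (XTheta Θ t ⁻¹' A) = volume A := by
  rw [volume_eq_lintegral_outerSlice_add_innerSlice (measurable_XTheta Θ t hA),
    volume_eq_lintegral_outerSlice_add_innerSlice hA,
    ← lintegral_comp_signedSqrt (4 * t) fun z => volume (innerSlice A z)]
  simp only [outerSlice_preimage_XTheta]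
  congr 1
  refine lintegral_congr_ae ?_
  filter_upwards [volume.ae_ne (0 : ℝ), volume.ae_ne (signedSqrt (4 * t))] with z hz hne
  refine volume_innerSlice_preimage_XTheta Θ ht A hz fun h => hne ?_
  rw [← sub_eq_zero.1 h, signedSqrt_mul_abs_self]

/-- For every `Θ ∈ (0,2π]` and `t ≥ 0`, the map `X^Θ(t,·)` preserves three-dimensional
Lebesgue measure: `𝓛³((X^Θ(t,·))⁻¹(A)) = 𝓛³(A)` for every Borel set `A ⊆ ℝ³`. In
particular (together with the ODE property) `X^Θ` is a regular Lagrangian flow of `b` with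
compressibility constant `L = 1`. -/
theorem XTheta_measure_preserving (Θ : ℝ) (hΘ : Θ ∈ Set.Ioc 0 (2 * Real.pi))
    (t : ℝ) (ht : 0 ≤ t) :
    (∀ A : Set (ℝ × ℝ × ℝ), MeasurableSet A →
      volume (XTheta Θ t ⁻¹' A) = volume A) ∧
    (∀ p : ℝ × ℝ × ℝ, p ≠ 0 →
      MeasureTheory.IntegrableOn (fun s => bb (XTheta Θ s p)) (Set.Icc 0 t) volume ∧
      XTheta Θ t p = p + ∫ s in (0 : ℝ)..t, bb (XTheta Θ s p)) := by
  exact ⟨fun A hA => volume_preimage_XTheta Θ ht hA, fun p _ => XTheta_integral_curve Θ ht p⟩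

end
end
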